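/- arXiv:1909.01756 — 2 statements merged into one kernel-verified Lean document; each statement's English description precedes it below -/
import Mathlib

section
/- Let K ≥ 6 be an integer and L = K − 3. On the node set V = (ZMod K) × Fin 3, with Avail(p′, q′) = {p′ + q′ + 1 + j (mod K) : j = 0, …, L−1}, a node w interferes with v = (p, q) if w ≠ v and p ∉ Avail(w). Then for every node v = (p, q), a node w interferes with v if and only if w ≠ v and w ∈ {(p, 0), (p, 1), (p, 2), (p+1, 0), (p+2, 0), (p−1, 1), (p+1, 1), (p−2, 2), (p−1, 2)} (indices mod K, columns zero-based); in particular, every node has exactly 8 interfering nodes. -/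
/-- For `L = K − 3`, a node `w = (p′, q′)` of the ICP (with `q′ : Fin 3` zero-based) has
`Avail K w = {p′ + q′ + 1 + j (mod K) : j = 0, …, (K−3)−1}`, the set of users at which
the subfile represented by `w` is available. -/
def Avail (K : ℕ) [NeZero K] (w : ZMod K × Fin 3) : Finset (ZMod K) :=
  (Finset.range (K - 3)).image (fun j : ℕ => w.1 + (w.2.val : ZMod K) + 1 + (j : ZMod K))

theorem ZMod.notMem_image_range_sub_three {K : ℕ} [NeZero K] (hK : 3 ≤ K) (a p : ZMod K) :
    p ∉ (Finset.range (K - 3)).image (fun j : ℕ => a + 1 + (j : ZMod K)) ↔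
      a = p ∨ a = p + 1 ∨ a = p + 2 := by
  have cast_sub (m : ℕ) (hm : m ≤ K) : ((K - m : ℕ) : ZMod K) = -m := by
    rw [Nat.cast_sub hm, ZMod.natCast_self, zero_sub]
  have val_eq (m : ℕ) (hm : 0 < m) (hmK : m ≤ K) (x : ZMod K) :
      x.val = K - m ↔ x = -m := by
    rw [← cast_sub m hmK]
    constructor
    · intro h
      rw [← h, ZMod.natCast_zmod_val]
    · rintro rfl
      exact ZMod.val_cast_of_lt (by omega)
  have mem_iff : p ∈ (Finset.range (K - 3)).image (fun j : ℕ => a + 1 + (j : ZMod K)) ↔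
      (p - a - 1).val < K - 3 := by
    simp only [Finset.mem_image, Finset.mem_range]
    constructor
    · rintro ⟨j, hj, rfl⟩
      rw [show a + 1 + (j : ZMod K) - a - 1 = j by ring, ZMod.val_cast_of_lt (by omega)]
      exact hj
    · intro h
      exact ⟨_, h, by rw [ZMod.natCast_zmod_val]; ring⟩
  have val_lt := ZMod.val_lt (p - a - 1)
  have cases_val : ¬ (p - a - 1).val < K - 3 ↔ (p - a - 1).val = K - 1 ∨
      (p - a - 1).val = K - 2 ∨ (p - a - 1).val = K - 3 := by omega
  rw [mem_iff, cases_val, val_eq 1 (by omega) (by omega), val_eq 2 (by omega) (by omega),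
    val_eq 3 (by omega) (by omega)]
  push_cast
  refine or_congr ?_ (or_congr ?_ ?_) <;> constructor <;> intro h <;> linear_combination -h

theorem notMem_Avail_iff {K : ℕ} [NeZero K] (hK : 3 ≤ K) (p : ZMod K) (w : ZMod K × Fin 3) :
    p ∉ Avail K w ↔ w = (p, 0) ∨ w = (p, 1) ∨ w = (p, 2) ∨
      w = (p + 1, 0) ∨ w = (p + 2, 0) ∨ w = (p - 1, 1) ∨ w = (p + 1, 1) ∨
      w = (p - 2, 2) ∨ w = (p - 1, 2) := by
  obtain ⟨a, q⟩ := w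
  rw [Avail, ZMod.notMem_image_range_sub_three hK]
  have h₁ : a + 1 = p ↔ a = p - 1 := eq_sub_iff_add_eq.symm
  have h₂ : a + 2 = p ↔ a = p - 2 := eq_sub_iff_add_eq.symm
  have h₃ : a + 1 = p + 2 ↔ a = p + 1 := by
    constructor <;> intro h <;> linear_combination h
  have h₄ : a + 2 = p + 1 ↔ a = p - 1 := by
    constructor <;> intro h <;> linear_combination h
  fin_cases q <;> simp [Prod.ext_iff, h₁, h₂, h₃, h₄] <;> tauto

/-- For `L = K − 3`, a node `w` interferes with `v = (p, q)` iff `w ≠ v` and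
`w ∈ {(p,0), (p,1), (p,2), (p+1,0), (p+2,0), (p−1,1), (p+1,1), (p−2,2), (p−1,2)}`;
in particular every node has exactly 8 interfering nodes. -/
theorem interference_characterization_L_eq_K_sub_three (K : ℕ) [NeZero K] (hK : 6 ≤ K)
    (v : ZMod K × Fin 3) :
    (∀ w : ZMod K × Fin 3,
        (w ≠ v ∧ v.1 ∉ Avail K w) ↔
          (w ≠ v ∧ (w = (v.1, 0) ∨ w = (v.1, 1) ∨ w = (v.1, 2) ∨
            w = (v.1 + 1, 0) ∨ w = (v.1 + 2, 0) ∨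
            w = (v.1 - 1, 1) ∨ w = (v.1 + 1, 1) ∨
            w = (v.1 - 2, 2) ∨ w = (v.1 - 1, 2)))) ∧
      (Finset.univ.filter (fun w : ZMod K × Fin 3 => w ≠ v ∧ v.1 ∉ Avail K w)).card = 8 := by
  have hK3 : 3 ≤ K := by omega
  refine ⟨fun w => and_congr_right fun _ => notMem_Avail_iff hK3 v.1 w, ?_⟩
  obtain ⟨p, q⟩ := v
  let S : Finset (ZMod K × Fin 3) :=
    {(p, 0), (p, 1), (p, 2), (p + 1, 0), (p + 2, 0), (p - 1, 1), (p + 1, 1), (p - 2, 2),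
      (p - 1, 2)}
  have filter_eq : Finset.univ.filter
      (fun w : ZMod K × Fin 3 => w ≠ (p, q) ∧ p ∉ Avail K w) = S.erase (p, q) := by
    ext w
    simp [S, notMem_Avail_iff hK3]
  have mem_S : (p, q) ∈ S := by
    fin_cases q <;> simp [S]
  have one_ne : (1 : ZMod K) ≠ 0 := by
    have : Fact (1 < K) := ⟨by omega⟩
    exact one_ne_zero
  have two_ne : (2 : ZMod K) ≠ 0 := by
    intro h
    have h' : ((2 : ℕ) : ZMod K) = 0 := by exact_mod_cast h
    have := Nat.le_of_dvd two_pos ((ZMod.natCast_eq_zero_iff 2 K).1 h')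
    omega
  have one_ne_two : (1 : ZMod K) ≠ 2 := fun h => one_ne (by linear_combination -h)
  have sub_one_ne_add_one : p - 1 ≠ p + 1 := fun h => two_ne (by linear_combination -h)
  have card_S : S.card = 9 := by
    simp [S, Finset.card_insert_of_notMem, one_ne, two_ne, one_ne_two, one_ne_two.symm,
      sub_one_ne_add_one, eq_comm (a := p)]
  rw [filter_eq, Finset.card_erase_of_mem mem_S, card_S]
end

section
/- Let K ≥ 6 be an even integer and L = K − 3. On the node set V = (ZMod K) × Fin 3, with Avail(p′, q′) = {p′ + q′ + 1 + j (mod K) : j = 0, …, L−1} and interference as defined, there exists a proper coloring c : V → ℕ (c(w) ≠ c(v) whenever w interferes with v) such that for every node v, the set of colors appearing on the closed anti-outneighborhood N⁺(v) = {v} ∪ {w : w interferes with v} has cardinality at most 6. -/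
theorem eq_of_notMem_avail {K : ℕ} [NeZero K] (hK : 3 ≤ K) {p : ZMod K} {w : ZMod K × Fin 3}
    (h : p ∉ Avail K w) :
    p = w.1 + (w.2.val : ZMod K) ∨ p = w.1 + (w.2.val : ZMod K) - 1 ∨
      p = w.1 + (w.2.val : ZMod K) - 2 := by
  obtain ⟨d, hd⟩ : ∃ d, d = p - (w.1 + (w.2.val : ZMod K) + 1) := ⟨_, rfl⟩
  have hlt : d.val < K := d.val_lt
  have hge : K - 3 ≤ d.val := by
    by_contra! hlt
    refine h (Finset.mem_image.2 ⟨d.val, Finset.mem_range.2 hlt, ?_⟩)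
    rw [ZMod.natCast_zmod_val, hd]
    ring
  have hcast : ∀ m : ℕ, d.val + m = K → d + (m : ZMod K) = 0 := by
    intro m hm
    have := congrArg (Nat.cast : ℕ → ZMod K) hm
    simpa using this
  have hcases : d.val + 1 = K ∨ d.val + 2 = K ∨ d.val + 3 = K := by omega
  rcases hcases with h1 | h2 | h3
  · have := hcast 1 h1
    push_cast at this
    left
    linear_combination this - hd
  · have := hcast 2 h2
    push_cast at this
    right; left
    linear_combination this - hd
  · have := hcast 3 h3
    push_cast at this
    right; right
    linear_combination this - hd

theorem natCast_zmod_ne_zero_of_lt {K m : ℕ} (hm : 0 < m) (h : m < K) : (m : ZMod K) ≠ 0 := by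
  rw [Ne, ZMod.natCast_eq_zero_iff]
  exact Nat.not_dvd_of_pos_of_lt hm h

/-- Nodes `(p, 0)` and `(p - 3, 2)` share the color `p`; nodes in the middle column get one of
two further colors according to the parity of their row. -/
def parityColoring {K : ℕ} (hKe : 2 ∣ K) (w : ZMod K × Fin 3) : ℕ :=
  match w.2 with
  | 0 => w.1.val
  | 1 => K + (ZMod.castHom hKe (ZMod 2) w.1).val
  | 2 => (w.1 + 3).val

/-- For `L = K − 3` with `K` even, there is a proper coloring of the ICP such that at
most `6 = (K−L)(K−L+1)/2` colors appear on the closed anti-outneighborhood of any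
node. -/
theorem coloring_L_eq_K_sub_three_even (K : ℕ) [NeZero K] (hK : 6 ≤ K) (hKe : Even K) :
    ∃ c : ZMod K × Fin 3 → ℕ,
      (∀ v w : ZMod K × Fin 3, (w ≠ v ∧ v.1 ∉ Avail K w) → c w ≠ c v) ∧
        ∀ v : ZMod K × Fin 3,
          ((insert v (Finset.univ.filter
              (fun w : ZMod K × Fin 3 => w ≠ v ∧ v.1 ∉ Avail K w))).image c).card ≤ 6 := by
  have h2K : 2 ∣ K := hKe.two_dvd
  have h1 : (1 : ZMod K) ≠ 0 := by
    exact_mod_cast natCast_zmod_ne_zero_of_lt (m := 1) (by omega) (by omega)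
  have h2 : (2 : ZMod K) ≠ 0 := by
    exact_mod_cast natCast_zmod_ne_zero_of_lt (m := 2) (by omega) (by omega)
  have h3 : (3 : ZMod K) ≠ 0 := by
    exact_mod_cast natCast_zmod_ne_zero_of_lt (m := 3) (by omega) (by omega)
  refine ⟨parityColoring h2K, ?_, ?_⟩
  · rintro ⟨p, q⟩ ⟨p', q'⟩ ⟨hne, hmem⟩ hc
    have hp := eq_of_notMem_avail (by omega) hmem
    have hlt := ZMod.val_lt p
    have hlt' := ZMod.val_lt p'
    have hlt3 := ZMod.val_lt (p + 3)
    have hlt3' := ZMod.val_lt (p' + 3)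
    fin_cases q <;> fin_cases q' <;> simp [parityColoring] at hc hp hne
    · exact hne (ZMod.val_injective K hc)
    · omega
    · have := ZMod.val_injective K hc
      grind
    · omega
    · have hpar : ZMod.castHom h2K (ZMod 2) p' = ZMod.castHom h2K (ZMod 2) p :=
        ZMod.val_injective 2 hc
      have hstep : ∀ x : ZMod 2, x ≠ x + 1 ∧ x ≠ x + 1 - 2 := by decide
      rcases hp with rfl | rfl | rfl
      · rw [map_add, map_one] at hpar
        exact (hstep _).1 hpar
      · grind
      · rw [map_sub, map_add, map_one, map_ofNat] at hpar
        exact (hstep _).2 hpar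
    · omega
    · have := ZMod.val_injective K hc
      grind
    · omega
    · have := ZMod.val_injective K hc
      grind
  · rintro ⟨p, q⟩
    refine (Finset.card_le_card (t := {p.val, (p + 1).val, (p + 2).val, (p + 3).val, K, K + 1})
      ?_).trans Finset.card_le_six
    have hpar : ∀ x : ZMod 2, x.val = 0 ∨ x.val = 1 := by decide
    rw [Finset.image_subset_iff]
    rintro ⟨p', q'⟩ hw
    have hp : p = p' + (q'.val : ZMod K) ∨ p = p' + (q'.val : ZMod K) - 1 ∨
        p = p' + (q'.val : ZMod K) - 2 := by
      rcases Finset.mem_insert.1 hw with h | h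
      · obtain ⟨rfl, rfl⟩ := Prod.mk.inj h
        fin_cases q' <;> simp
      · exact eq_of_notMem_avail (by omega) (Finset.mem_filter.1 h).2.2
    fin_cases q'
    · have : p' = p ∨ p' = p + 1 ∨ p' = p + 2 := by simp at hp; grind
      rcases this with rfl | rfl | rfl <;> simp [parityColoring]
    · rcases hpar (ZMod.castHom h2K (ZMod 2) p') with h | h <;>
        simp only [parityColoring, h] <;> simp
    · have : p' + 3 = p + 1 ∨ p' + 3 = p + 2 ∨ p' + 3 = p + 3 := by simp at hp; grind
      rcases this with h | h | h <;> simp [parityColoring, h]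
end
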